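/- For every finitely supported sequence f : ℕ → ℂ and every m ∈ ℕ, the inverse spherical transform formula holds: f(q^{2m}) = ∫_0^{2π/h} φ_ρ(q^{2m}) f̂(ρ) dσ(ρ), where f̂(ρ) = (1−q²) Σ_{n≥0} φ_ρ(q^{2n}) f(q^{2n}) q^{-2n}. -/

import Mathlib

open scoped BigOperators
open Complex

noncomputable section

/-- `q^w = exp(w · ln q)` for real `q > 0` and complex `w`. -/
noncomputable def qpow (q : ℝ) (w : ℂ) : ℂ := Complex.exp (w * (Real.log q : ℂ))

/-- The finite q-Pochhammer symbol `(a;Q)_n = ∏_{j=0}^{n-1} (1 − a Q^j)`. -/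
noncomputable def qPoch (a Q : ℂ) (n : ℕ) : ℂ := ∏ j ∈ Finset.range n, (1 - a * Q ^ j)

/-- The infinite q-Pochhammer symbol `(a;Q)_∞ = ∏_{j=0}^{∞} (1 − a Q^j)`. -/
noncomputable def qPochInf (a Q : ℂ) : ℂ := ∏' j : ℕ, (1 - a * Q ^ j)

/-- The eigenvalue `λ(ρ) = −(1−q^{1+2iρ})(1−q^{1−2iρ})/(1−q²)²`. -/
noncomputable def lambdaQ (q : ℝ) (ρ : ℂ) : ℂ :=
  -((1 - qpow q (1 + 2 * I * ρ)) * (1 - qpow q (1 - 2 * I * ρ))) / (1 - (q : ℂ) ^ 2) ^ 2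

/-- The general term of the series defining the Jost-type solution `ψ_ρ(q^{2m})`. -/
noncomputable def psiTerm (q : ℝ) (ρ : ℂ) (m k : ℕ) : ℂ :=
  (qPoch (qpow q (1 - 2 * I * ρ)) ((q : ℂ) ^ 2) k) ^ 2 * (q : ℂ) ^ (2 * k) *
      (q : ℂ) ^ (2 * k * m) /
    (qPoch (qpow q (2 - 4 * I * ρ)) ((q : ℂ) ^ 2) k * qPoch ((q : ℂ) ^ 2) ((q : ℂ) ^ 2) k)

/-- The Jost-type solution
`ψ_ρ(q^{2m}) = q^{(1−2iρ)m} Σ_{k≥0} ((q^{1−2iρ};q²)_k)² q^{2k} q^{2km} / ((q^{2−4iρ};q²)_k (q²;q²)_k)`. -/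
noncomputable def psiQ (q : ℝ) (ρ : ℂ) (m : ℕ) : ℂ :=
  qpow q ((1 - 2 * I * ρ) * (m : ℂ)) * ∑' k : ℕ, psiTerm q ρ m k

/-- The q-spherical function
`φ_ρ(q^{2m}) = Σ_{k=0}^{m} (q^{-2m};q²)_k (q^{1+2iρ};q²)_k (q^{1−2iρ};q²)_k q^{2k} / ((q²;q²)_k)²`. -/
noncomputable def phiQ (q : ℝ) (ρ : ℂ) (m : ℕ) : ℂ :=
  ∑ k ∈ Finset.range (m + 1),
    qPoch ((q : ℂ) ^ (-(2 * (m : ℤ)))) ((q : ℂ) ^ 2) k *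
        qPoch (qpow q (1 + 2 * I * ρ)) ((q : ℂ) ^ 2) k *
        qPoch (qpow q (1 - 2 * I * ρ)) ((q : ℂ) ^ 2) k * (q : ℂ) ^ (2 * k) /
      (qPoch ((q : ℂ) ^ 2) ((q : ℂ) ^ 2) k) ^ 2

/-- The q-Gamma function `Γ_{q²}(x) = (q²;q²)_∞ (1−q²)^{1−x} / (q^{2x};q²)_∞`, using the
principal branch of the complex power. -/
noncomputable def qGamma (q : ℝ) (x : ℂ) : ℂ :=
  qPochInf ((q : ℂ) ^ 2) ((q : ℂ) ^ 2) * ((1 : ℂ) - (q : ℂ) ^ 2) ^ ((1 : ℂ) - x) /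
    qPochInf (qpow q (2 * x)) ((q : ℂ) ^ 2)

/-- `h = ln(q^{-2})`. -/
noncomputable def hQ (q : ℝ) : ℝ := Real.log (q ^ (-2 : ℤ))

/-- The density of the Plancherel measure `dσ`:
`(1/(4π))·(h/(1−q²))·Γ_{q²}(1/2−iρ)² Γ_{q²}(1/2+iρ)² / (Γ_{q²}(−2iρ) Γ_{q²}(2iρ))`,
which is nonnegative real for real `ρ`. -/
noncomputable def sigmaDensity (q : ℝ) (ρ : ℝ) : ℂ :=
  (1 / (4 * (Real.pi : ℂ))) * ((hQ q : ℂ) / (1 - (q : ℂ) ^ 2)) *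
      (qGamma q (1 / 2 - I * (ρ : ℂ))) ^ 2 * (qGamma q (1 / 2 + I * (ρ : ℂ))) ^ 2 /
    (qGamma q (-(2 * I * (ρ : ℂ))) * qGamma q (2 * I * (ρ : ℂ)))

/-- The Borel measure `dσ` on `[0, 2π/h]` with density `sigmaDensity` with respect to
Lebesgue measure. -/
noncomputable def sigmaMeasure (q : ℝ) : MeasureTheory.Measure ℝ :=
  (MeasureTheory.volume.restrict (Set.Icc 0 (2 * Real.pi / hQ q))).withDensity
    (fun ρ => ENNReal.ofReal (sigmaDensity q ρ).re)

/-- The spherical transform `f̂(ρ) = (1−q²) Σ_{m≥0} φ_ρ(q^{2m}) f(q^{2m}) q^{-2m}`. -/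
noncomputable def sphTransform (q : ℝ) (f : ℕ → ℂ) (ρ : ℝ) : ℂ :=
  (1 - (q : ℂ) ^ 2) * ∑' m : ℕ, phiQ q (ρ : ℂ) m * f m * (q : ℂ) ^ (-(2 * (m : ℤ)))

/-- The weighted counting measure on ℕ with `ν {m} = (1−q²) q^{-2m}`, so that
`MeasureTheory.Lp ℂ 2 (nuMeasure q)` is the Hilbert space `L²(dν)q⁰` of sequences with inner
product `⟨f,g⟩ = (1−q²) Σ_{m≥0} conj(g(q^{2m})) f(q^{2m}) q^{-2m}`. -/
noncomputable def nuMeasure (q : ℝ) : MeasureTheory.Measure ℕ :=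
  MeasureTheory.Measure.count.withDensity
    (fun m => ENNReal.ofReal ((1 - q ^ 2) * q ^ (-(2 * (m : ℤ)))))

section QPochhammer

variable {Q : ℂ}

lemma qPoch_succ (a Q : ℂ) (n : ℕ) : qPoch a Q (n + 1) = qPoch a Q n * (1 - a * Q ^ n) :=
  Finset.prod_range_succ _ _

lemma qPoch_zero (a Q : ℂ) : qPoch a Q 0 = 1 := rfl

lemma qPoch_succ' (a Q : ℂ) (n : ℕ) : qPoch a Q (n + 1) = (1 - a) * qPoch (a * Q) Q n := by
  simp only [qPoch, Finset.prod_range_succ', pow_zero, mul_one]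
  rw [mul_comm]
  congr 1
  exact Finset.prod_congr rfl fun j _ => by ring

lemma qPoch_add (a Q : ℂ) (m n : ℕ) :
    qPoch a Q (m + n) = qPoch a Q m * qPoch (a * Q ^ m) Q n := by
  simp only [qPoch, Finset.prod_range_add]
  congr 1
  exact Finset.prod_congr rfl fun j _ => by ring

lemma pow_succ_ne_one (hQ : ‖Q‖ < 1) (n : ℕ) : Q ^ (n + 1) ≠ 1 := by
  intro h
  have := pow_lt_one₀ (norm_nonneg Q) hQ n.succ_ne_zero
  rw [← norm_pow, h] at this
  simp at this

lemma qPoch_self_ne_zero (hQ : ‖Q‖ < 1) (n : ℕ) : qPoch Q Q n ≠ 0 := by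
  refine Finset.prod_ne_zero_iff.2 fun j _ => sub_ne_zero.2 ?_
  rw [← pow_succ']
  exact (pow_succ_ne_one hQ j).symm

lemma summable_norm_mul_pow (hQ : ‖Q‖ < 1) (a : ℂ) : Summable fun j : ℕ => ‖-(a * Q ^ j)‖ := by
  simpa using (summable_geometric_of_lt_one (norm_nonneg _) hQ).mul_left ‖a‖

lemma multipliable_one_sub_mul_pow (hQ : ‖Q‖ < 1) (a : ℂ) :
    Multipliable fun j : ℕ => 1 - a * Q ^ j := by
  simpa [sub_eq_add_neg] using multipliable_one_add_of_summable (summable_norm_mul_pow hQ a)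

lemma qPochInf_eq_mul (hQ : ‖Q‖ < 1) (a : ℂ) :
    qPochInf a Q = (1 - a) * qPochInf (a * Q) Q := by
  have h : (fun j : ℕ => 1 - a * Q ^ (j + 1)) = fun j => 1 - a * Q * Q ^ j := by
    funext j; ring
  rw [qPochInf, tprod_eq_zero_mul' (by rw [h]; exact multipliable_one_sub_mul_pow hQ _), h]
  simp [qPochInf]

lemma qPochInf_ne_zero (hQ : ‖Q‖ < 1) {a : ℂ} (ha : ‖a‖ < 1) : qPochInf a Q ≠ 0 := by
  have := tprod_one_add_ne_zero_of_summable (f := fun j : ℕ => -(a * Q ^ j)) (fun j h => ?_)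
    (summable_norm_mul_pow hQ a)
  · simpa [sub_eq_add_neg, qPochInf] using this
  · have h1 : a * Q ^ j = 1 := by linear_combination -h
    have h2 : ‖a * Q ^ j‖ < 1 := by
      rw [norm_mul, norm_pow]
      exact mul_lt_one_of_nonneg_of_lt_one_left (norm_nonneg _) ha
        (pow_le_one₀ (norm_nonneg _) hQ.le)
    rw [h1] at h2
    simp at h2

lemma differentiable_qPochInf (hQ : ‖Q‖ < 1) : Differentiable ℂ fun a => qPochInf a Q := by
  intro a
  have hs : Summable fun j : ℕ => (‖a‖ + 1) * ‖Q‖ ^ j :=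
    (summable_geometric_of_lt_one (norm_nonneg _) hQ).mul_left _
  have h := hs.hasProdLocallyUniformlyOn_nat_one_add (f := fun j (x : ℂ) => -(x * Q ^ j))
    (Metric.isOpen_ball (x := a) (ε := 1)) (.of_forall fun j x hx => ?_) (fun _ => by fun_prop)
  · have h' := h.differentiableOn (.of_forall fun s => by
      simpa [Finset.prod_fn] using DifferentiableOn.finsetProd (fun _ _ => by fun_prop))
      Metric.isOpen_ball
    have := h'.differentiableAt (Metric.ball_mem_nhds a one_pos)
    simpa [sub_eq_add_neg, qPochInf] using this
  · rw [norm_neg, norm_mul, norm_pow]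
    gcongr
    have : ‖x - a‖ < 1 := by simpa [dist_eq_norm] using hx
    linarith [norm_sub_norm_le x a]

lemma conj_qPochInf (hQ : ‖Q‖ < 1) (hr : starRingEnd ℂ Q = Q) (a : ℂ) :
    starRingEnd ℂ (qPochInf a Q) = qPochInf (starRingEnd ℂ a) Q := by
  have := (multipliable_one_sub_mul_pow hQ a).map_tprod (starRingEnd ℂ) continuous_conj
  rw [qPochInf, this]
  simp [qPochInf, hr]

/-- The `q`-Chu–Vandermonde sum. -/
lemma qChuVandermonde (hQ0 : Q ≠ 0) (n : ℕ) : ∀ b c : ℂ, b ≠ 0 → (∀ j : ℕ, c * Q ^ j ≠ 1) →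
    (∀ j : ℕ, Q ^ (j + 1) ≠ 1) →
    ∑ k ∈ Finset.range (n + 1), qPoch (Q ^ (-(n : ℤ))) Q k * qPoch b Q k * Q ^ k /
      (qPoch Q Q k * qPoch c Q k) = b ^ n * qPoch (c / b) Q n / qPoch c Q n := by
  induction n with
  | zero => intro b c _ _ _; simp [qPoch_zero]
  | succ n ih =>
    intro b c hb hc hQ
    have hcn : ∀ (c : ℂ), (∀ j : ℕ, c * Q ^ j ≠ 1) → ∀ k, qPoch c Q k ≠ 0 := fun c hc k =>
      Finset.prod_ne_zero_iff.2 fun j _ => sub_ne_zero.2 (hc j).symm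
    have hQn : ∀ k, qPoch Q Q k ≠ 0 := hcn Q fun j => by rw [← pow_succ']; exact hQ j
    have hc' : ∀ j : ℕ, c * Q * Q ^ j ≠ 1 := fun j => by
      rw [mul_assoc, ← pow_succ']; exact hc _
    have h1c : 1 - c ≠ 0 := sub_ne_zero.2 (by simpa using (hc 0).symm)
    have hstep : ∀ k, qPoch (Q ^ (-((n + 1 : ℕ) : ℤ))) Q (k + 1) =
        qPoch (Q ^ (-(n : ℤ))) Q (k + 1) -
          Q ^ (-((n + 1 : ℕ) : ℤ)) * (1 - Q ^ (k + 1)) * qPoch (Q ^ (-(n : ℤ))) Q k := by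
      intro k
      have e : Q ^ (-((n + 1 : ℕ) : ℤ)) * Q = Q ^ (-(n : ℤ)) := by
        rw [← zpow_add_one₀ hQ0]; congr 1; push_cast; ring
      rw [qPoch_succ', e, qPoch_succ, ← e]
      ring
    have hterm : ∀ k, qPoch (Q ^ (-((n + 1 : ℕ) : ℤ))) Q (k + 1) * qPoch b Q (k + 1) *
        Q ^ (k + 1) / (qPoch Q Q (k + 1) * qPoch c Q (k + 1)) =
        qPoch (Q ^ (-(n : ℤ))) Q (k + 1) * qPoch b Q (k + 1) *
        Q ^ (k + 1) / (qPoch Q Q (k + 1) * qPoch c Q (k + 1)) -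
        Q ^ (-(n : ℤ)) * ((1 - b) / (1 - c)) * (qPoch (Q ^ (-(n : ℤ))) Q k * qPoch (b * Q) Q k *
        Q ^ k / (qPoch Q Q k * qPoch (c * Q) Q k)) := by
      intro k
      have e : Q ^ (-((n + 1 : ℕ) : ℤ)) * Q = Q ^ (-(n : ℤ)) := by
        rw [← zpow_add_one₀ hQ0]; congr 1; push_cast; ring
      have hk : 1 - Q * Q ^ k ≠ 0 := sub_ne_zero.2 (by rw [← pow_succ']; exact (hQ k).symm)
      rw [hstep, ← e, qPoch_succ' b, qPoch_succ' c, qPoch_succ Q]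
      have h2 := hQn k
      have h3 := hcn _ hc' k
      field_simp
      ring
    have hlast : qPoch (Q ^ (-(n : ℤ))) Q (n + 1) = 0 := by
      rw [qPoch_succ, ← zpow_natCast Q n, ← zpow_add₀ hQ0]; simp
    rw [Finset.sum_range_succ', Finset.sum_congr rfl fun k _ => hterm k, Finset.sum_sub_distrib,
      ← Finset.mul_sum, ih (b * Q) (c * Q) (mul_ne_zero hb hQ0) hc' hQ]
    have hS := ih b c hb hc hQ
    have hS' : ∑ k ∈ Finset.range (n + 2), qPoch (Q ^ (-(n : ℤ))) Q k * qPoch b Q k * Q ^ k /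
      (qPoch Q Q k * qPoch c Q k) = b ^ n * qPoch (c / b) Q n / qPoch c Q n := by
      rw [Finset.sum_range_succ, hS, hlast]; simp
    rw [Finset.sum_range_succ'] at hS'
    simp only [qPoch_zero] at hS' ⊢
    have h4 := hcn _ hc' n
    have h5 := hcn _ hc n
    have h6 := hcn _ hc (n + 1)
    have h7 : 1 - c * Q ^ n ≠ 0 := sub_ne_zero.2 (hc n).symm
    have h8 : qPoch c Q n * (1 - c * Q ^ n) = (1 - c) * qPoch (c * Q) Q n := by
      rw [← qPoch_succ, qPoch_succ']
    have h9 : qPoch (c * Q) Q n = qPoch c Q n * (1 - c * Q ^ n) / (1 - c) := by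
      rw [h8]; field_simp
    have h10 : c * Q / (b * Q) = c / b := by field_simp
    have h11 : Q ^ (-(n : ℤ)) * Q ^ n = 1 := by
      rw [← zpow_natCast Q n, ← zpow_add₀ hQ0]; simp
    rw [h10, h9, qPoch_succ, qPoch_succ c]
    rw [show ∀ x y z : ℂ, x - y + z = (x + z) - y from fun _ _ _ => by ring, hS', mul_pow,
      show ∀ x y z w : ℂ, Q ^ (-(n : ℤ)) * x * (y * Q ^ n * z / w) =
        (Q ^ (-(n : ℤ)) * Q ^ n) * x * (y * z / w) from fun _ _ _ _ => by ring, h11]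
    field_simp
    ring

end QPochhammer

section CircleIntegrals

open MeasureTheory intervalIntegral

@[fun_prop]
lemma DifferentiableAt.qPochInf {Q : ℂ} {f : ℂ → ℂ} {z : ℂ} (hf : DifferentiableAt ℂ f z)
    (hQ : ‖Q‖ < 1) : DifferentiableAt ℂ (fun w => qPochInf (f w) Q) z :=
  (differentiable_qPochInf hQ (f z)).comp z hf

lemma circleIntegral_zero_inv_mul (F : ℂ → ℂ) {R : ℝ} (hR : R ≠ 0) :
    (∮ z in C(0, R), z⁻¹ * F z) = I * ∫ θ in 0..2 * Real.pi, F (circleMap 0 R θ) := by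
  rw [circleIntegral, ← intervalIntegral.integral_const_mul]
  congr 1
  funext θ
  have h : circleMap 0 R θ ≠ 0 := circleMap_ne_center hR
  rw [deriv_circleMap, smul_eq_mul]
  field_simp

lemma integral_circleMap_eq_of_differentiableAt {F : ℂ → ℂ} {r R : ℝ} (hr : 0 < r) (hrR : r ≤ R)
    (hF : ∀ z, r ≤ ‖z‖ → ‖z‖ ≤ R → DifferentiableAt ℂ F z) :
    ∫ θ in 0..2 * Real.pi, F (circleMap 0 R θ) = ∫ θ in 0..2 * Real.pi, F (circleMap 0 r θ) := by
  have h := Complex.circleIntegral_sub_center_inv_smul_eq_of_differentiable_on_annulus_off_countable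
    (c := 0) hr hrR (f := F) Set.countable_empty
    (fun z hz => (hF z (by simpa using hz.2) (by simpa using hz.1)).continuousAt.continuousWithinAt)
    (fun z hz => by
      have h1 : ‖z‖ < R := by simpa using hz.1.1
      have h2 : r < ‖z‖ := by simpa using hz.1.2
      exact hF z h2.le h1.le)
  simp only [sub_zero, smul_eq_mul] at h
  rw [circleIntegral_zero_inv_mul F (hr.trans_le hrR).ne',
    circleIntegral_zero_inv_mul F hr.ne'] at h
  exact mul_left_cancel₀ I_ne_zero h

lemma circleMap_zero_eq_mul (R θ : ℝ) : circleMap 0 R θ = R * circleMap 0 1 θ := by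
  simp [circleMap]

lemma norm_circleMap_one (θ : ℝ) : ‖circleMap 0 1 θ‖ = 1 := by simp

/-- The Al-Salam–Chihara weight with parameters `a`, `b` in base `Q`. -/
def asWeight (Q a b z : ℂ) : ℂ :=
  qPochInf (z ^ 2) Q * qPochInf (z⁻¹ ^ 2) Q /
    (qPochInf (a * z) Q * qPochInf (a * z⁻¹) Q * (qPochInf (b * z) Q * qPochInf (b * z⁻¹) Q))

lemma asWeight_comm (Q a b z : ℂ) : asWeight Q a b z = asWeight Q b a z := by
  simp only [asWeight]
  ring

variable {Q a b : ℂ}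

lemma qPochInf_mul_ne_zero (hQ : ‖Q‖ < 1) (ha : ‖a‖ < 1) {z : ℂ} (hz : ‖z‖ ≤ 1) :
    qPochInf (a * z) Q ≠ 0 :=
  qPochInf_ne_zero hQ <| by
    rw [norm_mul]; exact mul_lt_one_of_nonneg_of_lt_one_left (norm_nonneg _) ha hz

lemma continuous_asWeight_circleMap (hQ : ‖Q‖ < 1) (ha : ‖a‖ < 1) (hb : ‖b‖ < 1) :
    Continuous fun θ : ℝ => asWeight Q a b (circleMap 0 1 θ) := by
  refine continuous_iff_continuousAt.2 fun θ => ?_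
  have hz := norm_circleMap_one θ
  have hz0 : circleMap 0 1 θ ≠ 0 := circleMap_ne_center one_ne_zero
  have hz' : ‖(circleMap 0 1 θ)⁻¹‖ = 1 := by rw [norm_inv, hz, inv_one]
  have h : DifferentiableAt ℂ (asWeight Q a b) (circleMap 0 1 θ) := by
    unfold asWeight
    have h1 := qPochInf_mul_ne_zero hQ ha hz.le
    have h2 := qPochInf_mul_ne_zero hQ ha hz'.le
    have h3 := qPochInf_mul_ne_zero hQ hb hz.le
    have h4 := qPochInf_mul_ne_zero hQ hb hz'.le
    refine DifferentiableAt.fun_div ?_ ?_ (by simp [h1, h2, h3, h4]) <;>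
    fun_prop (disch := assumption)
  exact ContinuousAt.comp (f := circleMap 0 1) (g := asWeight Q a b) h.continuousAt
    (continuous_circleMap 0 1).continuousAt

lemma asWeight_mul_right (hQ : ‖Q‖ < 1) (ha : ‖a‖ < 1) (hb : ‖b‖ < 1) {z : ℂ} (hz : ‖z‖ = 1) :
    asWeight Q (a * Q) b z = (1 - a * z) * (1 - a * z⁻¹) * asWeight Q a b z := by
  have hz' : ‖z⁻¹‖ = 1 := by rw [norm_inv, hz, inv_one]
  have h1 := qPochInf_mul_ne_zero hQ ha hz.le
  have h2 := qPochInf_mul_ne_zero hQ ha hz'.le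
  have h3 := qPochInf_mul_ne_zero hQ hb hz.le
  have h4 := qPochInf_mul_ne_zero hQ hb hz'.le
  simp only [asWeight]
  rw [qPochInf_eq_mul hQ (a * z)] at h1 ⊢
  rw [qPochInf_eq_mul hQ (a * z⁻¹)] at h2 ⊢
  rw [mul_right_comm a Q z, mul_right_comm a Q z⁻¹]
  have h5 := left_ne_zero_of_mul h1
  have h6 := right_ne_zero_of_mul h1
  have h7 := left_ne_zero_of_mul h2
  have h8 := right_ne_zero_of_mul h2
  generalize 1 - a * z⁻¹ = v at *
  generalize 1 - a * z = u at *
  field_simp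

lemma first_moment_difference_identity {q Q a b z y A A' B B' C C' : ℂ} (hzy : z * y = 1)
    (hq : q ≠ 0) (hQ : Q = q ^ 2) (h1 : 1 - a * z ≠ 0) (h2 : 1 - a * y ≠ 0) (h3 : 1 - b * z ≠ 0)
    (h4 : 1 - b * y ≠ 0) (hA : A ≠ 0) (hA' : A' ≠ 0) (hB : B ≠ 0) (hB' : B' ≠ 0) :
    (1 - z ^ 2) * ((1 - z ^ 2 * Q) * C) * ((1 - y ^ 2) * ((1 - y ^ 2 * Q) * C')) /
        ((1 - a * z) * A * ((1 - a * y) * A') * ((1 - b * z) * B * ((1 - b * y) * B'))) *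
      (z + y - a - b) =
    q * ((q⁻¹ * y - q * z) * (C * ((1 - y ^ 2) * ((1 - y ^ 2 * Q) * C'))) /
          (A * ((1 - a * y) * A') * (B * ((1 - b * y) * B'))) -
        (q * y - q⁻¹ * z) * ((1 - z ^ 2) * ((1 - z ^ 2 * Q) * C) * C') /
          ((1 - a * z) * A * A' * ((1 - b * z) * B * B'))) := by
  have e1 : q⁻¹ * y - q * z = q⁻¹ * (y * (1 - Q * z ^ 2)) := by
    rw [hQ]
    field_simp
    linear_combination (q ^ 2 * z) * hzy
  have e2 : q * y - q⁻¹ * z = -(q⁻¹ * (z * (1 - Q * y ^ 2))) := by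
    rw [hQ]
    field_simp
    linear_combination (-q ^ 2 * y) * hzy
  have e3 : (1 - z ^ 2) * (1 - y ^ 2) * (z + y - a - b) =
      y * (1 - y ^ 2) * ((1 - a * z) * (1 - b * z)) +
        z * (1 - z ^ 2) * ((1 - a * y) * (1 - b * y)) := by
    have hz : z ≠ 0 := left_ne_zero_of_mul_eq_one hzy
    obtain rfl : y = z⁻¹ := eq_inv_of_mul_eq_one_right hzy
    field_simp
    ring
  rw [e1, e2]
  generalize 1 - a * z = u at *
  generalize 1 - a * y = u' at *
  generalize 1 - b * z = v at *
  generalize 1 - b * y = v' at *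
  field_simp
  linear_combination (C * C' * (1 - z ^ 2 * Q) * (1 - y ^ 2 * Q)) * e3

/-- The first Al-Salam–Chihara polynomial has mean zero. -/
lemma integral_asWeight_mul_eq_zero {q : ℝ} (hq0 : 0 < q) (hq1 : q < 1) (ha : ‖a‖ < 1)
    (hb : ‖b‖ < 1) :
    ∫ θ in 0..2 * Real.pi, asWeight ((q : ℂ) ^ 2) a b (circleMap 0 1 θ) *
      (circleMap 0 1 θ + (circleMap 0 1 θ)⁻¹ - a - b) = 0 := by
  have hqc : (q : ℂ) ≠ 0 := by exact_mod_cast hq0.ne'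
  have hqn : ‖(q : ℂ)‖ = q := by simp [abs_of_pos hq0]
  set Q : ℂ := (q : ℂ) ^ 2 with hQdef
  have hQ : ‖Q‖ < 1 := by
    rw [hQdef, norm_pow, hqn]; exact pow_lt_one₀ hq0.le hq1 two_ne_zero
  let g : ℂ → ℂ := fun z => (z⁻¹ - z) * (qPochInf (Q * z ^ 2) Q * qPochInf (Q * z⁻¹ ^ 2) Q) /
    (qPochInf (a * (q * z)) Q * qPochInf (a * (q * z⁻¹)) Q *
      (qPochInf (b * (q * z)) Q * qPochInf (b * (q * z⁻¹)) Q))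
  have hg : ∀ z, q ≤ ‖z‖ → ‖z‖ ≤ q⁻¹ → DifferentiableAt ℂ g z := by
    intro z hz1 hz2
    have hz0 : z ≠ 0 := norm_pos_iff.1 (hq0.trans_le hz1)
    have hz : ‖(q : ℂ) * z‖ ≤ 1 := by
      rw [norm_mul, hqn]
      calc q * ‖z‖ ≤ q * q⁻¹ := by gcongr
        _ = 1 := mul_inv_cancel₀ hq0.ne'
    have hz' : ‖(q : ℂ) * z⁻¹‖ ≤ 1 := by
      rw [norm_mul, hqn, norm_inv]
      calc q * ‖z‖⁻¹ ≤ q * q⁻¹ := by gcongr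
        _ = 1 := mul_inv_cancel₀ hq0.ne'
    have h1 := qPochInf_mul_ne_zero hQ ha hz
    have h2 := qPochInf_mul_ne_zero hQ ha hz'
    have h3 := qPochInf_mul_ne_zero hQ hb hz
    have h4 := qPochInf_mul_ne_zero hQ hb hz'
    refine DifferentiableAt.fun_div ?_ ?_ (by simp [h1, h2, h3, h4]) <;>
    fun_prop (disch := assumption)
  have hkey : ∀ θ : ℝ, asWeight Q a b (circleMap 0 1 θ) *
      (circleMap 0 1 θ + (circleMap 0 1 θ)⁻¹ - a - b) =
      q * (g (circleMap 0 q θ) - g (circleMap 0 q⁻¹ θ)) := by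
    intro θ
    rw [circleMap_zero_eq_mul q, circleMap_zero_eq_mul q⁻¹, ofReal_inv]
    have hz := norm_circleMap_one θ
    have hz0 : circleMap 0 1 θ ≠ 0 := circleMap_ne_center one_ne_zero
    generalize circleMap 0 1 θ = z at *
    have hz' : ‖z⁻¹‖ = 1 := by rw [norm_inv, hz, inv_one]
    have h1 := qPochInf_mul_ne_zero hQ ha hz.le
    have h2 := qPochInf_mul_ne_zero hQ ha hz'.le
    have h3 := qPochInf_mul_ne_zero hQ hb hz.le
    have h4 := qPochInf_mul_ne_zero hQ hb hz'.le
    have r1 : Q * (q * z) ^ 2 = z ^ 2 * Q * Q := by rw [hQdef]; ring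
    have r2 : Q * (q * z)⁻¹ ^ 2 = z⁻¹ ^ 2 := by rw [hQdef]; field_simp
    have r3 : Q * ((q : ℂ)⁻¹ * z) ^ 2 = z ^ 2 := by rw [hQdef]; field_simp
    have r4 : Q * ((q : ℂ)⁻¹ * z)⁻¹ ^ 2 = z⁻¹ ^ 2 * Q * Q := by rw [hQdef]; field_simp
    have r5 : ∀ c : ℂ, c * (q * (q * z)) = c * z * Q := fun c => by rw [hQdef]; ring
    have r6 : ∀ c : ℂ, c * (q * (q * z)⁻¹) = c * z⁻¹ := fun c => by field_simp
    have r7 : ∀ c : ℂ, c * (q * ((q : ℂ)⁻¹ * z)) = c * z := fun c => by field_simp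
    have r8 : ∀ c : ℂ, c * (q * ((q : ℂ)⁻¹ * z)⁻¹) = c * z⁻¹ * Q := fun c => by
      rw [hQdef]; field_simp
    simp only [g, asWeight, r1, r2, r3, r4, r5, r6, r7, r8]
    rw [qPochInf_eq_mul hQ (z ^ 2), qPochInf_eq_mul hQ (z ^ 2 * Q), qPochInf_eq_mul hQ (z⁻¹ ^ 2),
      qPochInf_eq_mul hQ (z⁻¹ ^ 2 * Q)]
    rw [qPochInf_eq_mul hQ (a * z)] at h1 ⊢
    rw [qPochInf_eq_mul hQ (a * z⁻¹)] at h2 ⊢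
    rw [qPochInf_eq_mul hQ (b * z)] at h3 ⊢
    rw [qPochInf_eq_mul hQ (b * z⁻¹)] at h4 ⊢
    generalize qPochInf (a * z * Q) Q = A at *
    generalize qPochInf (a * z⁻¹ * Q) Q = A' at *
    generalize qPochInf (b * z * Q) Q = B at *
    generalize qPochInf (b * z⁻¹ * Q) Q = B' at *
    generalize qPochInf (z ^ 2 * Q * Q) Q = C
    generalize qPochInf (z⁻¹ ^ 2 * Q * Q) Q = C'
    have i1 := left_ne_zero_of_mul h1
    have i2 := right_ne_zero_of_mul h1
    have i3 := left_ne_zero_of_mul h2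
    have i4 := right_ne_zero_of_mul h2
    have i5 := left_ne_zero_of_mul h3
    have i6 := right_ne_zero_of_mul h3
    have i7 := left_ne_zero_of_mul h4
    have i8 := right_ne_zero_of_mul h4
    rw [mul_inv, mul_inv, inv_inv]
    exact first_moment_difference_identity (mul_inv_cancel₀ hz0) hqc hQdef i1 i3 i5 i7 i2 i4 i6 i8
  have hI := integral_circleMap_eq_of_differentiableAt hq0
    (hq1.le.trans ((one_le_inv₀ hq0).2 hq1.le)) hg
  have hc : ∀ R, q ≤ R → R ≤ q⁻¹ →
      IntervalIntegrable (fun θ => g (circleMap 0 R θ)) volume 0 (2 * Real.pi) := by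
    intro R h1 h2
    refine Continuous.intervalIntegrable (continuous_iff_continuousAt.2 fun θ => ?_) _ _
    have hn : ‖circleMap 0 R θ‖ = R := by simp [abs_of_pos (hq0.trans_le h1)]
    exact ContinuousAt.comp (f := circleMap 0 R) (g := g)
      (hg _ (by rw [hn]; exact h1) (by rw [hn]; exact h2)).continuousAt
      (continuous_circleMap 0 R).continuousAt
  have hqq : q ≤ q⁻¹ := hq1.le.trans ((one_le_inv₀ hq0).2 hq1.le)
  simp only [hkey]
  rw [intervalIntegral.integral_const_mul, intervalIntegral.integral_sub (hc _ le_rfl hqq)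
    (hc _ hqq le_rfl), hI, sub_self, mul_zero]

lemma integral_asWeight_mul_left {q : ℝ} (hq0 : 0 < q) (hq1 : q < 1) (ha : ‖a‖ < 1)
    (hb : ‖b‖ < 1) :
    ∫ θ in 0..2 * Real.pi, asWeight ((q : ℂ) ^ 2) (a * (q : ℂ) ^ 2) b (circleMap 0 1 θ) =
      (1 - a * b) * ∫ θ in 0..2 * Real.pi, asWeight ((q : ℂ) ^ 2) a b (circleMap 0 1 θ) := by
  have hQ : ‖(q : ℂ) ^ 2‖ < 1 := by
    rw [norm_pow, norm_real, Real.norm_of_nonneg hq0.le]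
    exact pow_lt_one₀ hq0.le hq1 two_ne_zero
  have h := integral_asWeight_mul_eq_zero hq0 hq1 ha hb
  have hcw := continuous_asWeight_circleMap hQ ha hb
  have hci : Continuous fun θ : ℝ => (circleMap 0 1 θ)⁻¹ :=
    (continuous_circleMap 0 1).inv₀ fun θ => circleMap_ne_center one_ne_zero
  have hcm := continuous_circleMap 0 1
  have hp : ∀ θ, asWeight ((q : ℂ) ^ 2) (a * (q : ℂ) ^ 2) b (circleMap 0 1 θ) =
      (1 - a * b) * asWeight ((q : ℂ) ^ 2) a b (circleMap 0 1 θ) -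
      a * (asWeight ((q : ℂ) ^ 2) a b (circleMap 0 1 θ) *
      (circleMap 0 1 θ + (circleMap 0 1 θ)⁻¹ - a - b)) := by
    intro θ
    rw [asWeight_mul_right hQ ha hb (norm_circleMap_one θ)]
    have hz0 : circleMap 0 1 θ ≠ 0 := circleMap_ne_center one_ne_zero
    have h1 : (1 - a * circleMap 0 1 θ) * (1 - a * (circleMap 0 1 θ)⁻¹) =
        (1 - a * b) - a * (circleMap 0 1 θ + (circleMap 0 1 θ)⁻¹ - a - b) := by
      linear_combination a ^ 2 * mul_inv_cancel₀ hz0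
    rw [h1]
    ring
  simp only [hp]
  rw [intervalIntegral.integral_sub, intervalIntegral.integral_const_mul,
    intervalIntegral.integral_const_mul, h, mul_zero, sub_zero]
  · exact (continuous_const.mul hcw).intervalIntegrable _ _
  · exact (continuous_const.mul (hcw.mul (((hcm.add hci).sub continuous_const).sub
      continuous_const))).intervalIntegrable _ _

lemma integral_circleMap_div_sub_of_lt {w : ℂ} {R : ℝ} (hw : ‖w‖ < R) :
    ∫ θ in 0..2 * Real.pi, circleMap 0 R θ / (circleMap 0 R θ - w) = 2 * Real.pi := by
  have hR : R ≠ 0 := ((norm_nonneg w).trans_lt hw).ne'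
  have h := circleIntegral_zero_inv_mul (fun z => z / (z - w)) hR
  have h2 : (∮ z in C(0, R), z⁻¹ * (z / (z - w))) = ∮ z in C(0, R), (z - w)⁻¹ := by
    refine circleIntegral.integral_congr ((norm_nonneg w).trans hw.le) fun z hz => ?_
    have hz0 : z ≠ 0 := by
      rintro rfl
      simp at hz
      exact hR hz.symm
    field_simp
  rw [h2, circleIntegral.integral_sub_inv_of_mem_ball (by simpa using hw)] at h
  refine mul_left_cancel₀ I_ne_zero ?_
  rw [← h]
  ring

lemma integral_circleMap_div_sub_of_gt {w : ℂ} {R : ℝ} (hR : 0 < R) (hw : R < ‖w‖) :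
    ∫ θ in 0..2 * Real.pi, circleMap 0 R θ / (circleMap 0 R θ - w) = 0 := by
  have h := circleIntegral_zero_inv_mul (fun z => z / (z - w)) hR.ne'
  have h2 : (∮ z in C(0, R), z⁻¹ * (z / (z - w))) = ∮ z in C(0, R), (z - w)⁻¹ := by
    refine circleIntegral.integral_congr hR.le fun z hz => ?_
    have hz0 : z ≠ 0 := by
      rintro rfl
      simp at hz
      exact hR.ne hz
    field_simp
  have hne : ∀ z : ℂ, ‖z‖ ≤ R → z - w ≠ 0 := by
    intro z hz h0
    rw [sub_eq_zero.1 h0] at hz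
    exact absurd hz (not_le.2 hw)
  have h3 : (∮ z in C(0, R), (z - w)⁻¹) = 0 := by
    refine Complex.circleIntegral_eq_zero_of_differentiable_on_off_countable hR.le
      Set.countable_empty (fun z hz => ?_) (fun z hz => ?_)
    · exact (((continuous_id.sub continuous_const).continuousAt).inv₀
        (hne z (by simpa using hz))).continuousWithinAt
    · have hz' : ‖z‖ < R := by simpa using hz.1
      exact ((differentiableAt_id).sub_const w).inv (hne z hz'.le)
  rw [h2, h3] at h
  exact (mul_eq_zero.1 h.symm).resolve_left I_ne_zero

/-- A circle integral version of the residue theorem for one simple pole in an annulus. -/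
lemma integral_circleMap_sub_eq_residue {G : ℂ → ℂ} {w : ℂ} {r R : ℝ} (hr : 0 < r) (hrw : r < ‖w‖)
    (hwR : ‖w‖ < R) (hG : ∀ z, r ≤ ‖z‖ → ‖z‖ ≤ R → DifferentiableAt ℂ G z) :
    (∫ θ in 0..2 * Real.pi, circleMap 0 R θ * G (circleMap 0 R θ) / (circleMap 0 R θ - w)) -
      (∫ θ in 0..2 * Real.pi, circleMap 0 r θ * G (circleMap 0 r θ) / (circleMap 0 r θ - w)) =
      2 * Real.pi * G w := by
  have hd : ∀ z, r ≤ ‖z‖ → ‖z‖ ≤ R → DifferentiableAt ℂ (fun z => z * dslope G w z) z := by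
    intro z h1 h2
    refine differentiableAt_id.mul ?_
    rcases eq_or_ne z w with rfl | hzw
    · have hs : {z : ℂ | r < ‖z‖ ∧ ‖z‖ < R} ∈ nhds z :=
        ((isOpen_lt continuous_const continuous_norm).inter
          (isOpen_lt continuous_norm continuous_const)).mem_nhds ⟨hrw, hwR⟩
      exact ((Complex.differentiableOn_dslope hs).2 fun y hy =>
        (hG y hy.1.le hy.2.le).differentiableWithinAt).differentiableAt hs
    · exact (differentiableAt_dslope_of_ne hzw).2 (hG z h1 h2)
  have hsplit : ∀ z, z ≠ w → z * G z / (z - w) = z * dslope G w z + G w * (z / (z - w)) := by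
    intro z hzw
    have : z - w ≠ 0 := sub_ne_zero.2 hzw
    rw [dslope_of_ne _ hzw, slope_def_field]
    field_simp
    ring
  have hint : ∀ ρ : ℝ, r ≤ ρ → ρ ≤ R → ρ ≠ ‖w‖ →
      ∫ θ in 0..2 * Real.pi, circleMap 0 ρ θ * G (circleMap 0 ρ θ) / (circleMap 0 ρ θ - w) =
      (∫ θ in 0..2 * Real.pi, circleMap 0 ρ θ * dslope G w (circleMap 0 ρ θ)) +
        G w * ∫ θ in 0..2 * Real.pi, circleMap 0 ρ θ / (circleMap 0 ρ θ - w) := by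
    intro ρ h1 h2 h3
    have hn : ∀ θ, ‖circleMap 0 ρ θ‖ = ρ := fun θ => by simp [abs_of_pos (hr.trans_le h1)]
    have hne : ∀ θ, circleMap 0 ρ θ ≠ w := fun θ h => h3 (by rw [← h, hn])
    rw [← intervalIntegral.integral_const_mul, ← intervalIntegral.integral_add]
    · exact intervalIntegral.integral_congr fun θ _ => hsplit _ (hne θ)
    · refine Continuous.intervalIntegrable (continuous_iff_continuousAt.2 fun θ => ?_) _ _
      exact ContinuousAt.comp (f := circleMap 0 ρ) (g := fun z => z * dslope G w z)
        (hd _ (by rw [hn]; exact h1) (by rw [hn]; exact h2)).continuousAt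
        (continuous_circleMap 0 ρ).continuousAt
    · exact (continuous_const.mul ((continuous_circleMap 0 ρ).div
        ((continuous_circleMap 0 ρ).sub continuous_const)
        fun θ => sub_ne_zero.2 (hne θ))).intervalIntegrable _ _
  have hrR : r ≤ R := (hrw.trans hwR).le
  rw [hint R hrR le_rfl hwR.ne', hint r le_rfl hrR hrw.ne,
    integral_circleMap_div_sub_of_lt hwR, integral_circleMap_div_sub_of_gt hr hrw,
    integral_circleMap_eq_of_differentiableAt hr hrR hd]
  ring

lemma base_weight_difference_identity {q Q z y A A' C C' : ℂ} (hzy : z * y = 1)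
    (hq : q ≠ 0) (hQ : Q = q ^ 2) (h1 : 1 - q * z ≠ 0) (h2 : 1 - q * y ≠ 0)
    (hA : A ≠ 0) (hA' : A' ≠ 0) :
    (1 - z ^ 2) * ((1 - z ^ 2 * Q) * C) * ((1 - y ^ 2) * ((1 - y ^ 2 * Q) * C')) /
        ((1 - q * z) * A * ((1 - q * y) * A') * ((1 - q * z) * A * ((1 - q * y) * A'))) =
    z * ((1 + q * y) * ((1 - z ^ 2) * ((1 - z ^ 2 * Q) * C) * C') /
        ((1 - q * z) * A * A') ^ 2) / (z - q) -
      Q * z * ((1 + q * (Q⁻¹ * y)) * (C * ((1 - y ^ 2) * ((1 - y ^ 2 * Q) * C'))) /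
        (A * ((1 - q * y) * A')) ^ 2) / (Q * z - q) := by
  have hz : z ≠ 0 := left_ne_zero_of_mul_eq_one hzy
  have e1 : z - q = z * (1 - q * y) := by linear_combination q * hzy
  have e2 : Q * z - q = -(q * (1 - q * z)) := by rw [hQ]; ring
  have e3 : 1 + q * (Q⁻¹ * y) = q⁻¹ * y * (1 + q * z) := by
    rw [hQ]
    field_simp
    linear_combination -q * hzy
  have e4 : 1 - z ^ 2 * Q = (1 - q * z) * (1 + q * z) := by rw [hQ]; ring
  have e5 : 1 - y ^ 2 * Q = (1 - q * y) * (1 + q * y) := by rw [hQ]; ring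
  have e6 : (1 - z ^ 2) * (1 - y ^ 2) = (1 - z ^ 2) + (1 - y ^ 2) := by
    linear_combination (z * y + 1) * hzy
  rw [e1, e2, e3, e4, e5, hQ]
  generalize 1 - q * z = u at *
  generalize 1 - q * y = u' at *
  have e7 : z * y = 1 := hzy
  obtain rfl : z = y⁻¹ := eq_inv_of_mul_eq_one_left hzy
  have hy : y ≠ 0 := by simpa using hz
  field_simp at e6 ⊢
  linear_combination e6

/-- The total mass of the Al-Salam–Chihara weight with both parameters equal to `q`. -/
lemma integral_asWeight_self {q : ℝ} (hq0 : 0 < q) (hq1 : q < 1) :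
    ∫ θ in 0..2 * Real.pi, asWeight ((q : ℂ) ^ 2) q q (circleMap 0 1 θ) =
      4 * Real.pi / qPochInf ((q : ℂ) ^ 2) ((q : ℂ) ^ 2) ^ 2 := by
  have hqc : (q : ℂ) ≠ 0 := by exact_mod_cast hq0.ne'
  have hqn : ‖(q : ℂ)‖ = q := by simp [abs_of_pos hq0]
  have hq2 : q ^ 2 < q := by nlinarith
  set Q : ℂ := (q : ℂ) ^ 2 with hQdef
  have hQn : ‖Q‖ = q ^ 2 := by rw [hQdef, norm_pow, hqn]
  have hQ : ‖Q‖ < 1 := hQn ▸ hq2.trans hq1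
  let G : ℂ → ℂ := fun z => (1 + q * z⁻¹) *
    (qPochInf (z ^ 2) Q * qPochInf (Q * Q * z⁻¹ ^ 2) Q) /
    (qPochInf (q * z) Q * qPochInf (q * (Q * z⁻¹)) Q) ^ 2
  have hG : ∀ z, q ^ 2 ≤ ‖z‖ → ‖z‖ ≤ 1 → DifferentiableAt ℂ G z := by
    intro z hz1 hz2
    have hz0 : z ≠ 0 := norm_pos_iff.1 ((pow_pos hq0 2).trans_le hz1)
    have hz' : ‖Q * z⁻¹‖ ≤ 1 := by
      rw [norm_mul, hQn, norm_inv, ← div_eq_mul_inv]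
      exact div_le_one_of_le₀ hz1 (norm_nonneg _)
    have h1 := qPochInf_mul_ne_zero hQ (hqn.trans_lt hq1) hz2
    have h2 := qPochInf_mul_ne_zero hQ (hqn.trans_lt hq1) hz'
    refine DifferentiableAt.fun_div ?_ ?_ (by simp [h1, h2]) <;>
    fun_prop (disch := assumption)
  have hres := integral_circleMap_sub_eq_residue (G := G) (w := q) (r := q ^ 2) (R := 1)
    (pow_pos hq0 2) (by rw [hqn]; exact hq2) (by rw [hqn]; exact hq1) hG
  have hGq : G q = 2 / qPochInf Q Q ^ 2 := by
    have h0 : qPochInf Q Q ≠ 0 := qPochInf_ne_zero hQ hQ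
    have e1 : Q * Q * (q : ℂ)⁻¹ ^ 2 = Q := by rw [hQdef]; field_simp
    have e2 : (q : ℂ) * (Q * (q : ℂ)⁻¹) = Q := by field_simp
    simp only [G, e1, e2, mul_inv_cancel₀ hqc, ← pow_two (q : ℂ), ← hQdef]
    field_simp
    norm_num
  have hkey : ∀ θ : ℝ, asWeight Q q q (circleMap 0 1 θ) =
      circleMap 0 1 θ * G (circleMap 0 1 θ) / (circleMap 0 1 θ - q) -
      circleMap 0 (q ^ 2) θ * G (circleMap 0 (q ^ 2) θ) / (circleMap 0 (q ^ 2) θ - q) := by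
    intro θ
    rw [circleMap_zero_eq_mul (q ^ 2), ofReal_pow, ← hQdef]
    have hz := norm_circleMap_one θ
    have hz0 : circleMap 0 1 θ ≠ 0 := circleMap_ne_center one_ne_zero
    generalize circleMap 0 1 θ = z at *
    have hz' : ‖z⁻¹‖ = 1 := by rw [norm_inv, hz, inv_one]
    have h1 := qPochInf_mul_ne_zero hQ (hqn.trans_lt hq1) hz.le
    have h2 := qPochInf_mul_ne_zero hQ (hqn.trans_lt hq1) hz'.le
    have r1 : (Q * z) ^ 2 = z ^ 2 * Q * Q := by ring
    have r2 : Q * Q * (Q * z)⁻¹ ^ 2 = z⁻¹ ^ 2 := by rw [hQdef]; field_simp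
    have r3 : (q : ℂ) * (Q * z) = q * z * Q := by ring
    have r4 : (q : ℂ) * (Q * (Q * z)⁻¹) = q * z⁻¹ := by rw [hQdef]; field_simp
    have r5 : Q * Q * z⁻¹ ^ 2 = z⁻¹ ^ 2 * Q * Q := by ring
    have r6 : (q : ℂ) * (Q * z⁻¹) = q * z⁻¹ * Q := by ring
    simp only [G, asWeight, r1, r2, r3, r4, r5, r6]
    rw [qPochInf_eq_mul hQ (z ^ 2), qPochInf_eq_mul hQ (z ^ 2 * Q), qPochInf_eq_mul hQ (z⁻¹ ^ 2),
      qPochInf_eq_mul hQ (z⁻¹ ^ 2 * Q)]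
    rw [qPochInf_eq_mul hQ (q * z)] at h1 ⊢
    rw [qPochInf_eq_mul hQ (q * z⁻¹)] at h2 ⊢
    rw [mul_inv Q z]
    exact base_weight_difference_identity (mul_inv_cancel₀ hz0) hqc hQdef (left_ne_zero_of_mul h1)
      (left_ne_zero_of_mul h2) (right_ne_zero_of_mul h1) (right_ne_zero_of_mul h2)
  have hc : ∀ R, q ^ 2 ≤ R → R ≤ 1 → R ≠ q → IntervalIntegrable (fun θ =>
      circleMap 0 R θ * G (circleMap 0 R θ) / (circleMap 0 R θ - q)) volume 0 (2 * Real.pi) := by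
    intro R h1 h2 h3
    have hn : ∀ θ, ‖circleMap 0 R θ‖ = R := fun θ => by
      simp [abs_of_pos ((pow_pos hq0 2).trans_le h1)]
    refine Continuous.intervalIntegrable (((continuous_circleMap 0 R).mul
      (continuous_iff_continuousAt.2 fun θ => ?_)).div
      ((continuous_circleMap 0 R).sub continuous_const) fun θ => sub_ne_zero.2 fun h =>
        h3 (by rw [← hn θ, h, hqn])) _ _
    exact ContinuousAt.comp (f := circleMap 0 R) (g := G)
      (hG _ (by rw [hn]; exact h1) (by rw [hn]; exact h2)).continuousAt
      (continuous_circleMap 0 R).continuousAt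
  simp only [hkey]
  rw [intervalIntegral.integral_sub (hc 1 (hq2.trans hq1).le le_rfl hq1.ne')
    (hc _ le_rfl (hq2.trans hq1).le hq2.ne), hres, hGq]
  ring

end CircleIntegrals

section Orthogonality

open MeasureTheory intervalIntegral

/-- The coefficient of `(qz;q²)_k (q/z;q²)_k` in the spherical function `φ(q^{2m})`. -/
def sphCoeff (Q : ℂ) (m k : ℕ) : ℂ := qPoch (Q ^ (-(m : ℤ))) Q k * Q ^ k / qPoch Q Q k ^ 2

/-- The spherical function as a Laurent polynomial in `z = q^{-2iρ}`. -/
def sphPoly (q : ℝ) (m : ℕ) (z : ℂ) : ℂ :=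
  ∑ k ∈ Finset.range (m + 1), sphCoeff ((q : ℂ) ^ 2) m k *
    (qPoch (q * z) ((q : ℂ) ^ 2) k * qPoch (q * z⁻¹) ((q : ℂ) ^ 2) k)

lemma sum_sphCoeff_mul_qPoch_add {Q : ℂ} (hQ0 : Q ≠ 0) (hQ : ‖Q‖ < 1) (m j : ℕ) :
    ∑ k ∈ Finset.range (m + 1), sphCoeff Q m k * qPoch Q Q (k + j) =
      qPoch Q Q j * ((Q ^ (j + 1)) ^ m * qPoch (Q ^ (-(j : ℤ))) Q m / qPoch Q Q m) := by
  have hpow := pow_succ_ne_one hQ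
  have h := qChuVandermonde hQ0 m (Q ^ (j + 1)) Q (pow_ne_zero _ hQ0)
    (fun i => by rw [← pow_succ']; exact hpow i) hpow
  have e : Q / Q ^ (j + 1) = Q ^ (-(j : ℤ)) := by
    rw [zpow_neg, zpow_natCast, pow_succ]
    field_simp
  rw [e] at h
  rw [← h, Finset.mul_sum]
  refine Finset.sum_congr rfl fun k _ => ?_
  rw [add_comm k j, qPoch_add, ← pow_succ', sphCoeff]
  ring

lemma qPoch_zpow_neg_eq_zero {Q : ℂ} (hQ0 : Q ≠ 0) {j m : ℕ} (h : j < m) :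
    qPoch (Q ^ (-(j : ℤ))) Q m = 0 :=
  Finset.prod_eq_zero (Finset.mem_range.2 h) <| by
    rw [← zpow_natCast Q j, ← zpow_add₀ hQ0]; simp

lemma qPoch_zpow_neg_self {Q : ℂ} (hQ0 : Q ≠ 0) (m : ℕ) :
    qPoch (Q ^ (-(m : ℤ))) Q m ^ 2 * Q ^ (m * (m + 1)) = qPoch Q Q m ^ 2 := by
  induction m with
  | zero => simp [qPoch_zero]
  | succ m ih =>
    have e : Q ^ (-((m + 1 : ℕ) : ℤ)) * Q = Q ^ (-(m : ℤ)) := by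
      rw [← zpow_add_one₀ hQ0]; congr 1; push_cast; ring
    have e2 : Q ^ (-((m + 1 : ℕ) : ℤ)) * Q ^ (m + 1) = 1 := by
      rw [← zpow_natCast Q (m + 1), ← zpow_add₀ hQ0]; simp
    rw [qPoch_succ', e, qPoch_succ, mul_pow, mul_pow, ← ih]
    have e3 : (1 - Q ^ (-((m + 1 : ℕ) : ℤ))) ^ 2 * Q ^ (2 * (m + 1)) = (1 - Q * Q ^ m) ^ 2 := by
      calc _ = (Q ^ (m + 1) - Q ^ (-((m + 1 : ℕ) : ℤ)) * Q ^ (m + 1)) ^ 2 := by ring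
        _ = _ := by rw [e2]; ring
    rw [← e3]
    ring

lemma sum_sphCoeff_mul_sphCoeff_of_le {Q : ℂ} (hQ0 : Q ≠ 0) (hQ : ‖Q‖ < 1) {m n : ℕ} (h : n ≤ m) :
    ∑ j ∈ Finset.range (n + 1), ∑ k ∈ Finset.range (m + 1),
      sphCoeff Q n j * (sphCoeff Q m k * qPoch Q Q (k + j)) = if m = n then Q ^ m else 0 := by
  simp only [← Finset.mul_sum, sum_sphCoeff_mul_qPoch_add hQ0 hQ]
  rw [Finset.sum_range_succ, Finset.sum_eq_zero, zero_add]
  · split_ifs with hmn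
    · subst hmn
      have h1 := qPoch_self_ne_zero hQ m
      rw [sphCoeff]
      have h2 := qPoch_zpow_neg_self hQ0 m
      rw [← pow_mul, mul_comm (m + 1) m]
      field_simp
      rw [h2]
    · rw [qPoch_zpow_neg_eq_zero hQ0 (lt_of_le_of_ne h (Ne.symm hmn))]
      simp
  · intro j hj
    rw [qPoch_zpow_neg_eq_zero hQ0 ((Finset.mem_range.1 hj).trans_le h)]
    simp

variable {q : ℝ}

lemma norm_sq_ofReal_lt_one (hq0 : 0 < q) (hq1 : q < 1) : ‖(q : ℂ) ^ 2‖ < 1 := by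
  rw [norm_pow, norm_real, Real.norm_of_nonneg hq0.le]
  exact pow_lt_one₀ hq0.le hq1 two_ne_zero

lemma norm_mul_pow_lt_one {Q : ℂ} (hQ : ‖Q‖ < 1) {a : ℂ} (ha : ‖a‖ < 1) (k : ℕ) :
    ‖a * Q ^ k‖ < 1 := by
  rw [norm_mul, norm_pow]
  exact mul_lt_one_of_nonneg_of_lt_one_left (norm_nonneg _) ha
    (pow_le_one₀ (norm_nonneg _) hQ.le)

lemma asWeight_mul_pow {Q a b z : ℂ} (hQ : ‖Q‖ < 1) (ha : ‖a‖ < 1) (hb : ‖b‖ < 1)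
    (hz : ‖z‖ = 1) (k : ℕ) :
    asWeight Q (a * Q ^ k) b z =
      qPoch (a * z) Q k * qPoch (a * z⁻¹) Q k * asWeight Q a b z := by
  induction k with
  | zero => simp [qPoch_zero]
  | succ k ih =>
    rw [pow_succ, ← mul_assoc, asWeight_mul_right hQ (norm_mul_pow_lt_one hQ ha k) hb hz, ih,
      qPoch_succ, qPoch_succ]
    ring

lemma integral_asWeight_mul_pow (hq0 : 0 < q) (hq1 : q < 1) {a b : ℂ} (ha : ‖a‖ < 1)
    (hb : ‖b‖ < 1) (k : ℕ) :
    ∫ θ in 0..2 * Real.pi, asWeight ((q : ℂ) ^ 2) (a * ((q : ℂ) ^ 2) ^ k) b (circleMap 0 1 θ) =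
      qPoch (a * b) ((q : ℂ) ^ 2) k *
        ∫ θ in 0..2 * Real.pi, asWeight ((q : ℂ) ^ 2) a b (circleMap 0 1 θ) := by
  have hQ := norm_sq_ofReal_lt_one hq0 hq1
  induction k with
  | zero => simp [qPoch_zero]
  | succ k ih =>
    rw [pow_succ ((q : ℂ) ^ 2) k, ← mul_assoc a,
      integral_asWeight_mul_left hq0 hq1 (norm_mul_pow_lt_one hQ ha k) hb, ih, qPoch_succ]
    ring

lemma integral_qPoch_mul_asWeight (hq0 : 0 < q) (hq1 : q < 1) (k j : ℕ) :
    ∫ θ in 0..2 * Real.pi,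
      (qPoch (q * circleMap 0 1 θ) ((q : ℂ) ^ 2) j *
        qPoch (q * (circleMap 0 1 θ)⁻¹) ((q : ℂ) ^ 2) j) *
      ((qPoch (q * circleMap 0 1 θ) ((q : ℂ) ^ 2) k *
        qPoch (q * (circleMap 0 1 θ)⁻¹) ((q : ℂ) ^ 2) k) *
      asWeight ((q : ℂ) ^ 2) q q (circleMap 0 1 θ)) =
      qPoch ((q : ℂ) ^ 2) ((q : ℂ) ^ 2) (k + j) *
        (4 * Real.pi / qPochInf ((q : ℂ) ^ 2) ((q : ℂ) ^ 2) ^ 2) := by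
  have hQ := norm_sq_ofReal_lt_one hq0 hq1
  have hq : ‖(q : ℂ)‖ < 1 := by simpa [abs_of_pos hq0] using hq1
  have hqk := norm_mul_pow_lt_one hQ hq k
  have hqj := norm_mul_pow_lt_one hQ hq j
  have e : ∀ θ : ℝ, (qPoch (q * circleMap 0 1 θ) ((q : ℂ) ^ 2) j *
        qPoch (q * (circleMap 0 1 θ)⁻¹) ((q : ℂ) ^ 2) j) *
      ((qPoch (q * circleMap 0 1 θ) ((q : ℂ) ^ 2) k *
        qPoch (q * (circleMap 0 1 θ)⁻¹) ((q : ℂ) ^ 2) k) *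
      asWeight ((q : ℂ) ^ 2) q q (circleMap 0 1 θ)) =
      asWeight ((q : ℂ) ^ 2) (q * ((q : ℂ) ^ 2) ^ j) (q * ((q : ℂ) ^ 2) ^ k)
        (circleMap 0 1 θ) := by
    intro θ
    rw [asWeight_mul_pow hQ hq hqk (norm_circleMap_one θ),
      asWeight_comm _ (q : ℂ) ((q : ℂ) * ((q : ℂ) ^ 2) ^ k),
      asWeight_mul_pow hQ hq hq (norm_circleMap_one θ)]
  simp only [e]
  rw [integral_asWeight_mul_pow hq0 hq1 hq hqk]
  simp only [asWeight_comm _ (q : ℂ) ((q : ℂ) * ((q : ℂ) ^ 2) ^ k)]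
  rw [integral_asWeight_mul_pow hq0 hq1 hq hq, integral_asWeight_self hq0 hq1, qPoch_add,
    ← pow_two (q : ℂ), ← mul_assoc (q : ℂ), ← pow_two (q : ℂ)]
  ring

lemma continuous_qPoch_circleMap (q : ℝ) (k : ℕ) : Continuous fun θ : ℝ =>
    qPoch (q * circleMap 0 1 θ) ((q : ℂ) ^ 2) k *
      qPoch (q * (circleMap 0 1 θ)⁻¹) ((q : ℂ) ^ 2) k := by
  have hci : Continuous fun θ : ℝ => (circleMap 0 1 θ)⁻¹ :=
    (continuous_circleMap 0 1).inv₀ fun θ => circleMap_ne_center one_ne_zero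
  have hcm := continuous_circleMap 0 1
  unfold qPoch
  fun_prop

lemma continuous_sphPoly_circleMap (q : ℝ) (m : ℕ) :
    Continuous fun θ : ℝ => sphPoly q m (circleMap 0 1 θ) := by
  have := continuous_qPoch_circleMap q
  unfold sphPoly
  fun_prop

/-- Orthogonality of the spherical functions with respect to the Al-Salam–Chihara weight. -/
lemma integral_sphPoly_mul_sphPoly (hq0 : 0 < q) (hq1 : q < 1) (m n : ℕ) :
    ∫ θ in 0..2 * Real.pi, sphPoly q m (circleMap 0 1 θ) * sphPoly q n (circleMap 0 1 θ) *
      asWeight ((q : ℂ) ^ 2) q q (circleMap 0 1 θ) =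
      (if m = n then ((q : ℂ) ^ 2) ^ m else 0) *
        (4 * Real.pi / qPochInf ((q : ℂ) ^ 2) ((q : ℂ) ^ 2) ^ 2) := by
  have hQ := norm_sq_ofReal_lt_one hq0 hq1
  have hQ0 : (q : ℂ) ^ 2 ≠ 0 := pow_ne_zero _ (by exact_mod_cast hq0.ne')
  have hq : ‖(q : ℂ)‖ < 1 := by simpa [abs_of_pos hq0] using hq1
  wlog h : n ≤ m generalizing m n
  · have := this n m (not_le.1 h).le
    rw [if_neg (not_le.1 h).ne'] at this
    rw [if_neg (not_le.1 h).ne, ← this]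
    congr 1
    funext θ
    ring
  have hcw := continuous_asWeight_circleMap hQ hq hq
  have hcp := continuous_qPoch_circleMap q
  have hexp : ∀ θ : ℝ, sphPoly q m (circleMap 0 1 θ) * sphPoly q n (circleMap 0 1 θ) *
      asWeight ((q : ℂ) ^ 2) q q (circleMap 0 1 θ) =
      ∑ j ∈ Finset.range (n + 1), ∑ k ∈ Finset.range (m + 1),
        sphCoeff ((q : ℂ) ^ 2) n j * sphCoeff ((q : ℂ) ^ 2) m k *
        ((qPoch (q * circleMap 0 1 θ) ((q : ℂ) ^ 2) j *
          qPoch (q * (circleMap 0 1 θ)⁻¹) ((q : ℂ) ^ 2) j) *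
        ((qPoch (q * circleMap 0 1 θ) ((q : ℂ) ^ 2) k *
          qPoch (q * (circleMap 0 1 θ)⁻¹) ((q : ℂ) ^ 2) k) *
        asWeight ((q : ℂ) ^ 2) q q (circleMap 0 1 θ))) := by
    intro θ
    rw [mul_comm (sphPoly q m _), sphPoly, sphPoly, Finset.sum_mul_sum, Finset.sum_mul]
    refine Finset.sum_congr rfl fun j _ => ?_
    rw [Finset.sum_mul]
    exact Finset.sum_congr rfl fun k _ => by ring
  have hcont : ∀ j k : ℕ, Continuous fun θ : ℝ =>
      sphCoeff ((q : ℂ) ^ 2) n j * sphCoeff ((q : ℂ) ^ 2) m k *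
        ((qPoch (q * circleMap 0 1 θ) ((q : ℂ) ^ 2) j *
          qPoch (q * (circleMap 0 1 θ)⁻¹) ((q : ℂ) ^ 2) j) *
        ((qPoch (q * circleMap 0 1 θ) ((q : ℂ) ^ 2) k *
          qPoch (q * (circleMap 0 1 θ)⁻¹) ((q : ℂ) ^ 2) k) *
        asWeight ((q : ℂ) ^ 2) q q (circleMap 0 1 θ))) := fun j k =>
    continuous_const.mul ((hcp j).mul ((hcp k).mul hcw))
  simp only [hexp]
  rw [intervalIntegral.integral_finsetSum fun j _ =>
    (continuous_finsetSum _ fun k _ => hcont j k).intervalIntegrable _ _]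
  rw [← sum_sphCoeff_mul_sphCoeff_of_le hQ0 hQ h, Finset.sum_mul]
  refine Finset.sum_congr rfl fun j _ => ?_
  rw [intervalIntegral.integral_finsetSum fun k _ => (hcont j k).intervalIntegrable _ _,
    Finset.sum_mul]
  refine Finset.sum_congr rfl fun k _ => ?_
  rw [intervalIntegral.integral_const_mul, integral_qPoch_mul_asWeight hq0 hq1]
  ring

end Orthogonality

section SphericalTransform

open MeasureTheory

variable {q : ℝ}

lemma hQ_eq (q : ℝ) : hQ q = -2 * Real.log q := by
  rw [hQ, Real.log_zpow]; push_cast; ring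

lemma hQ_pos (hq0 : 0 < q) (hq1 : q < 1) : 0 < hQ q := by
  have := Real.log_neg hq0 hq1
  rw [hQ_eq]; linarith

lemma circleMap_hQ_mul (q ρ : ℝ) :
    circleMap 0 1 (hQ q * ρ) = Complex.exp (-(2 * I * ρ) * Real.log q) := by
  simp only [circleMap, hQ_eq, zero_add, ofReal_one, one_mul]
  congr 1; push_cast; ring

lemma qpow_add (q : ℝ) (x y : ℂ) : qpow q (x + y) = qpow q x * qpow q y := by
  rw [qpow, add_mul, Complex.exp_add]; rfl

lemma qpow_one (hq0 : 0 < q) : qpow q 1 = q := by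
  rw [qpow, one_mul, ← ofReal_exp, Real.exp_log hq0]

lemma qpow_neg_two_mul_I (q ρ : ℝ) : qpow q (-(2 * I * ρ)) = circleMap 0 1 (hQ q * ρ) :=
  (circleMap_hQ_mul q ρ).symm

lemma qpow_two_mul_I (q ρ : ℝ) : qpow q (2 * I * ρ) = (circleMap 0 1 (hQ q * ρ))⁻¹ := by
  rw [circleMap_hQ_mul, ← Complex.exp_neg, qpow]; congr 1; ring

lemma qpow_one_sub (hq0 : 0 < q) (ρ : ℝ) :
    qpow q (1 - 2 * I * ρ) = q * circleMap 0 1 (hQ q * ρ) := by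
  rw [sub_eq_add_neg, qpow_add, qpow_one hq0, qpow_neg_two_mul_I]

lemma qpow_one_add (hq0 : 0 < q) (ρ : ℝ) :
    qpow q (1 + 2 * I * ρ) = q * (circleMap 0 1 (hQ q * ρ))⁻¹ := by
  rw [qpow_add, qpow_one hq0, qpow_two_mul_I]

lemma phiQ_eq_sphPoly (hq0 : 0 < q) (ρ : ℝ) (m : ℕ) :
    phiQ q ρ m = sphPoly q m (circleMap 0 1 (hQ q * ρ)) := by
  rw [phiQ, sphPoly]
  refine Finset.sum_congr rfl fun k _ => ?_
  rw [qpow_one_sub hq0, qpow_one_add hq0, sphCoeff]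
  have e : (q : ℂ) ^ (-(2 * (m : ℤ))) = ((q : ℂ) ^ 2) ^ (-(m : ℤ)) := by
    rw [← zpow_natCast (q : ℂ) 2, ← zpow_mul]; congr 1; push_cast; ring
  rw [e, pow_mul]
  ring

lemma one_sub_sq_ne_zero (hq0 : 0 < q) (hq1 : q < 1) : (1 : ℂ) - (q : ℂ) ^ 2 ≠ 0 := by
  have : q ^ 2 < 1 := pow_lt_one₀ hq0.le hq1 two_ne_zero
  exact_mod_cast (sub_pos.2 this).ne'

lemma sigmaDensity_eq_asWeight (hq0 : 0 < q) (hq1 : q < 1) (ρ : ℝ) :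
    sigmaDensity q ρ = hQ q * qPochInf ((q : ℂ) ^ 2) ((q : ℂ) ^ 2) ^ 2 /
      (4 * Real.pi * (1 - (q : ℂ) ^ 2)) *
        asWeight ((q : ℂ) ^ 2) q q (circleMap 0 1 (hQ q * ρ)) := by
  have hQn := norm_sq_ofReal_lt_one hq0 hq1
  have hq : ‖(q : ℂ)‖ < 1 := by simpa [abs_of_pos hq0] using hq1
  have hz := norm_circleMap_one (hQ q * ρ)
  have hc := one_sub_sq_ne_zero hq0 hq1
  have hA := qPochInf_ne_zero hQn hQn
  have hX := qPochInf_mul_ne_zero hQn hq hz.le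
  have hY := qPochInf_mul_ne_zero (z := (circleMap 0 1 (hQ q * ρ))⁻¹) hQn hq
    (by rw [norm_inv, hz, inv_one])
  have e1 : qpow q (2 * (1 / 2 - I * ρ)) = q * circleMap 0 1 (hQ q * ρ) := by
    rw [← qpow_one_sub hq0]; congr 1; ring
  have e2 : qpow q (2 * (1 / 2 + I * ρ)) = q * (circleMap 0 1 (hQ q * ρ))⁻¹ := by
    rw [← qpow_one_add hq0]; congr 1; ring
  have e3 : qpow q (2 * -(2 * I * ρ)) = circleMap 0 1 (hQ q * ρ) ^ 2 := by
    rw [two_mul, qpow_add, qpow_neg_two_mul_I, pow_two]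
  have e4 : qpow q (2 * (2 * I * ρ)) = (circleMap 0 1 (hQ q * ρ))⁻¹ ^ 2 := by
    rw [two_mul, qpow_add, qpow_two_mul_I, pow_two]
  have c1 : (1 - (q : ℂ) ^ 2) ^ (1 - (1 / 2 - I * ρ)) * (1 - (q : ℂ) ^ 2) ^ (1 - (1 / 2 + I * ρ)) =
      1 - (q : ℂ) ^ 2 := by
    rw [← cpow_add _ _ hc]
    conv_rhs => rw [← cpow_one (1 - (q : ℂ) ^ 2)]
    congr 1; ring
  have c2 : (1 - (q : ℂ) ^ 2) ^ (1 - -(2 * I * ρ)) * (1 - (q : ℂ) ^ 2) ^ (1 - 2 * I * ρ) =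
      (1 - (q : ℂ) ^ 2) ^ 2 := by
    rw [← cpow_add _ _ hc, ← cpow_natCast (1 - (q : ℂ) ^ 2) 2]
    congr 1; push_cast; ring
  simp only [sigmaDensity, qGamma, asWeight, e1, e2, e3, e4]
  generalize qPochInf (circleMap 0 1 (hQ q * ρ) ^ 2) ((q : ℂ) ^ 2) = U
  generalize qPochInf ((circleMap 0 1 (hQ q * ρ))⁻¹ ^ 2) ((q : ℂ) ^ 2) = V
  revert hX hY
  generalize qPochInf (q * circleMap 0 1 (hQ q * ρ)) ((q : ℂ) ^ 2) = X
  generalize qPochInf (q * (circleMap 0 1 (hQ q * ρ))⁻¹) ((q : ℂ) ^ 2) = Y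
  intro hX hY
  revert c1 c2
  generalize ((1 - (q : ℂ) ^ 2) ^ (1 - (1 / 2 - I * ρ))) = x1
  generalize ((1 - (q : ℂ) ^ 2) ^ (1 - (1 / 2 + I * ρ))) = x2
  generalize ((1 - (q : ℂ) ^ 2) ^ (1 - -(2 * I * ρ))) = x3
  generalize ((1 - (q : ℂ) ^ 2) ^ (1 - 2 * I * (ρ : ℂ))) = x4
  intro c1 c2
  revert hc c1 c2
  generalize (1 - (q : ℂ) ^ 2) = c
  intro hc c1 c2
  revert hA
  generalize qPochInf ((q : ℂ) ^ 2) ((q : ℂ) ^ 2) = A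
  intro hA
  calc
    _ = 1 / (4 * (Real.pi : ℂ)) * ((hQ q : ℂ) / c) *
        (A ^ 4 * (x1 * x2) ^ 2 / (X * Y * (X * Y))) / (A ^ 2 * (x3 * x4)) * (U * V) := by
      simp only [div_eq_mul_inv, mul_inv, inv_inv]
      ring
    _ = _ := by
      rw [c1, c2]
      have hpi : (Real.pi : ℂ) ≠ 0 := by exact_mod_cast Real.pi_ne_zero
      field_simp

lemma asWeight_self_eq_normSq (hq0 : 0 < q) (hq1 : q < 1) {z : ℂ} (hz : ‖z‖ = 1) :
    asWeight ((q : ℂ) ^ 2) q q z = ((Complex.normSq (qPochInf (z ^ 2) ((q : ℂ) ^ 2)) /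
      Complex.normSq (qPochInf (q * z) ((q : ℂ) ^ 2)) ^ 2 : ℝ) : ℂ) := by
  have hQn := norm_sq_ofReal_lt_one hq0 hq1
  have hr : starRingEnd ℂ ((q : ℂ) ^ 2) = (q : ℂ) ^ 2 := by simp
  have hzi : z⁻¹ = starRingEnd ℂ z := Complex.inv_eq_conj hz
  push_cast
  rw [← Complex.mul_conj, ← Complex.mul_conj, conj_qPochInf hQn hr, conj_qPochInf hQn hr, asWeight,
    map_mul, map_pow, conj_ofReal, hzi, pow_two (_ * _)]

lemma ofReal_toReal_sigmaDensity (hq0 : 0 < q) (hq1 : q < 1) (ρ : ℝ) :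
    (((ENNReal.ofReal (sigmaDensity q ρ).re).toReal : ℝ) : ℂ) = sigmaDensity q ρ := by
  have hQn := norm_sq_ofReal_lt_one hq0 hq1
  have hr : starRingEnd ℂ ((q : ℂ) ^ 2) = (q : ℂ) ^ 2 := by simp
  have hA : qPochInf ((q : ℂ) ^ 2) ((q : ℂ) ^ 2) =
      ((qPochInf ((q : ℂ) ^ 2) ((q : ℂ) ^ 2)).re : ℂ) := by
    refine (Complex.conj_eq_iff_re.1 ?_).symm
    rw [conj_qPochInf hQn hr, hr]
  have hc : 0 ≤ 1 - q ^ 2 := sub_nonneg.2 (pow_le_one₀ hq0.le hq1.le)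
  obtain ⟨x, hx, e⟩ : ∃ x : ℝ, 0 ≤ x ∧ sigmaDensity q ρ = x := by
    rw [sigmaDensity_eq_asWeight hq0 hq1, asWeight_self_eq_normSq hq0 hq1 (norm_circleMap_one _),
      hA]
    have hh := (hQ_pos hq0 hq1).le
    refine ⟨hQ q * (qPochInf ((q : ℂ) ^ 2) ((q : ℂ) ^ 2)).re ^ 2 / (4 * Real.pi * (1 - q ^ 2)) *
      (Complex.normSq (qPochInf (circleMap 0 1 (hQ q * ρ) ^ 2) ((q : ℂ) ^ 2)) /
      Complex.normSq (qPochInf (q * circleMap 0 1 (hQ q * ρ)) ((q : ℂ) ^ 2)) ^ 2), ?_, ?_⟩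
    · have := Complex.normSq_nonneg (qPochInf (circleMap 0 1 (hQ q * ρ) ^ 2) ((q : ℂ) ^ 2))
      have := Real.pi_pos
      positivity
    · push_cast; rfl
  rw [e, ofReal_re, ENNReal.toReal_ofReal hx]

lemma continuous_sigmaDensity (hq0 : 0 < q) (hq1 : q < 1) : Continuous (sigmaDensity q) := by
  have hq : ‖(q : ℂ)‖ < 1 := by simpa [abs_of_pos hq0] using hq1
  rw [funext (sigmaDensity_eq_asWeight hq0 hq1)]
  exact continuous_const.mul ((continuous_asWeight_circleMap (norm_sq_ofReal_lt_one hq0 hq1) hq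
    hq).comp (continuous_const.mul continuous_id))

lemma continuous_phiQ (hq0 : 0 < q) (m : ℕ) : Continuous fun ρ : ℝ => phiQ q ρ m := by
  simp only [phiQ_eq_sphPoly hq0]
  exact (continuous_sphPoly_circleMap q m).comp (continuous_const.mul continuous_id)

lemma integral_sigmaMeasure (hq0 : 0 < q) (hq1 : q < 1) (F : ℝ → ℂ) :
    ∫ ρ, F ρ ∂(sigmaMeasure q) =
      ∫ ρ in 0..2 * Real.pi / hQ q, sigmaDensity q ρ * F ρ := by
  have hle : 0 ≤ 2 * Real.pi / hQ q := div_nonneg Real.two_pi_pos.le (hQ_pos hq0 hq1).le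
  have hm : Measurable fun ρ => ENNReal.ofReal (sigmaDensity q ρ).re :=
    (Complex.continuous_re.comp (continuous_sigmaDensity hq0 hq1)).measurable.ennreal_ofReal
  rw [sigmaMeasure, integral_withDensity_eq_integral_toReal_smul hm
    (Filter.Eventually.of_forall fun _ => ENNReal.ofReal_lt_top),
    intervalIntegral.integral_of_le hle, integral_Icc_eq_integral_Ioc]
  simp only [Complex.real_smul, ofReal_toReal_sigmaDensity hq0 hq1]

/-- Orthogonality of the spherical functions with respect to the Plancherel measure. -/
lemma integral_sigmaDensity_mul_phiQ_mul_phiQ (hq0 : 0 < q) (hq1 : q < 1) (m n : ℕ) :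
    ∫ ρ in 0..2 * Real.pi / hQ q, sigmaDensity q ρ * (phiQ q ρ m * phiQ q ρ n) =
      (if m = n then ((q : ℂ) ^ 2) ^ m else 0) / (1 - (q : ℂ) ^ 2) := by
  have hQn := norm_sq_ofReal_lt_one hq0 hq1
  have hh := (hQ_pos hq0 hq1).ne'
  have hc := one_sub_sq_ne_zero hq0 hq1
  have hA := qPochInf_ne_zero hQn hQn
  have hpi : (Real.pi : ℂ) ≠ 0 := by exact_mod_cast Real.pi_ne_zero
  have hhc : (hQ q : ℂ) ≠ 0 := by exact_mod_cast hh
  have hsub := intervalIntegral.integral_comp_mul_left (a := 0) (b := 2 * Real.pi / hQ q)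
    (fun θ => sphPoly q m (circleMap 0 1 θ) * sphPoly q n (circleMap 0 1 θ) *
      asWeight ((q : ℂ) ^ 2) q q (circleMap 0 1 θ)) hh
  rw [mul_zero, mul_div_cancel₀ _ hh, integral_sphPoly_mul_sphPoly hq0 hq1] at hsub
  have e : ∀ ρ : ℝ, sigmaDensity q ρ * (phiQ q ρ m * phiQ q ρ n) =
      hQ q * qPochInf ((q : ℂ) ^ 2) ((q : ℂ) ^ 2) ^ 2 / (4 * Real.pi * (1 - (q : ℂ) ^ 2)) *
      (sphPoly q m (circleMap 0 1 (hQ q * ρ)) *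
        sphPoly q n (circleMap 0 1 (hQ q * ρ)) *
        asWeight ((q : ℂ) ^ 2) q q (circleMap 0 1 (hQ q * ρ))) := by
    intro ρ
    rw [sigmaDensity_eq_asWeight hq0 hq1, phiQ_eq_sphPoly hq0, phiQ_eq_sphPoly hq0]
    ring
  simp only [e]
  rw [intervalIntegral.integral_const_mul, hsub, Complex.real_smul]
  push_cast
  field_simp

lemma sphTransform_eq_sum (q : ℝ) {f : ℕ → ℂ} (hf : (Function.support f).Finite) (ρ : ℝ) :
    sphTransform q f ρ = (1 - (q : ℂ) ^ 2) *
      ∑ n ∈ hf.toFinset, phiQ q ρ n * f n * (q : ℂ) ^ (-(2 * (n : ℤ))) := by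
  rw [sphTransform, tsum_eq_sum]
  intro n hn
  have : f n = 0 := by simpa using hn
  simp [this]

end SphericalTransform

/-- the inverse spherical transform formula
`f(q^{2m}) = ∫_0^{2π/h} φ_ρ(q^{2m}) f̂(ρ) dσ(ρ)` for finitely supported `f`. -/
theorem sphTransform_inversion (q : ℝ) (hq : q ∈ Set.Ioo (0 : ℝ) 1)
    (f : ℕ → ℂ) (hf : (Function.support f).Finite) :
    ∀ m : ℕ, f m = ∫ ρ : ℝ, phiQ q (ρ : ℂ) m * sphTransform q f ρ ∂(sigmaMeasure q) := by
  intro m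
  obtain ⟨hq0, hq1⟩ := hq
  have hc := one_sub_sq_ne_zero hq0 hq1
  have hqc : (q : ℂ) ≠ 0 := by exact_mod_cast hq0.ne'
  have hexp : ∀ ρ : ℝ, sigmaDensity q ρ * (phiQ q ρ m * sphTransform q f ρ) =
      ∑ n ∈ hf.toFinset, ((1 - (q : ℂ) ^ 2) * f n * (q : ℂ) ^ (-(2 * (n : ℤ)))) *
        (sigmaDensity q ρ * (phiQ q ρ m * phiQ q ρ n)) := by
    intro ρ
    rw [sphTransform_eq_sum q hf, Finset.mul_sum, Finset.mul_sum, Finset.mul_sum]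
    exact Finset.sum_congr rfl fun n _ => by ring
  have hcont : ∀ n : ℕ, Continuous fun ρ : ℝ =>
      ((1 - (q : ℂ) ^ 2) * f n * (q : ℂ) ^ (-(2 * (n : ℤ)))) *
        (sigmaDensity q ρ * (phiQ q ρ m * phiQ q ρ n)) := fun n =>
    continuous_const.mul ((continuous_sigmaDensity hq0 hq1).mul
      ((continuous_phiQ hq0 m).mul (continuous_phiQ hq0 n)))
  rw [integral_sigmaMeasure hq0 hq1]
  simp only [hexp]
  rw [intervalIntegral.integral_finsetSum fun n _ => (hcont n).intervalIntegrable _ _]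
  simp only [intervalIntegral.integral_const_mul,
    integral_sigmaDensity_mul_phiQ_mul_phiQ hq0 hq1]
  rw [Finset.sum_eq_single m]
  · rw [if_pos rfl, zpow_neg, ← pow_mul]
    have e : (q : ℂ) ^ (2 * (m : ℤ)) = (q : ℂ) ^ (2 * m) := by
      rw [← zpow_natCast]; congr 1
    rw [e]
    field_simp
  · intro n _ hn
    rw [if_neg hn.symm]; simp
  · intro hm
    have : f m = 0 := by simpa using hm
    simp [this]

end
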